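/- The degree sequence 6, 5, 5, 5, 3, 3, 3 is unigraphic: any two simple graphs on 7 vertices, each having one vertex of degree 6, three vertices of degree 5 and three vertices of degree 3, are isomorphic. (The unique realisation is the polyhedron obtained from the tetrahedron by three face splittings.) -/

import Mathlib

def canonA : Fin 7 → Fin 7 → ℕ :=
  ![![0,1,1,1,1,1,1], ![1,0,1,1,0,1,1], ![1,1,0,1,1,0,1], ![1,1,1,0,1,1,0],
    ![1,0,1,1,0,0,0], ![1,1,0,1,0,0,0], ![1,1,1,0,0,0,0]]

lemma facts (A : Fin 7 → Fin 7 → ℕ) (hs : ∀ i j, A i j = A j i)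
    (hd : ∀ i, A i i = 0) (h1 : ∀ i j, A i j ≤ 1)
    (hsum : ∀ i, ∑ j, A i j = (![6,5,5,5,3,3,3] : Fin 7 → ℕ) i) :
    (A 0 1 = 1 ∧ A 0 2 = 1 ∧ A 0 3 = 1 ∧ A 0 4 = 1 ∧ A 0 5 = 1 ∧ A 0 6 = 1) ∧
    (A 1 2 = 1 ∧ A 1 3 = 1 ∧ A 2 3 = 1) ∧ (A 4 5 = 0 ∧ A 4 6 = 0 ∧ A 5 6 = 0) ∧
    (A 1 4 + A 1 5 + A 1 6 = 2 ∧ A 2 4 + A 2 5 + A 2 6 = 2 ∧ A 3 4 + A 3 5 + A 3 6 = 2) ∧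
    (A 1 4 + A 2 4 + A 3 4 = 2 ∧ A 1 5 + A 2 5 + A 3 5 = 2 ∧ A 1 6 + A 2 6 + A 3 6 = 2) := by
  have s0 := hsum 0
  have s1 := hsum 1
  have s2 := hsum 2
  have s3 := hsum 3
  have s4 := hsum 4
  have s5 := hsum 5
  have s6 := hsum 6
  simp [Fin.sum_univ_seven, hd, hs 1 0, hs 2 0, hs 3 0, hs 4 0, hs 5 0, hs 6 0, hs 2 1, hs 3 1,
    hs 4 1, hs 5 1, hs 6 1, hs 3 2, hs 4 2, hs 5 2, hs 6 2, hs 4 3, hs 5 3, hs 6 3, hs 5 4, hs 6 4,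
    hs 6 5] at s0 s1 s2 s3 s4 s5 s6
  have b01 := h1 0 1
  have b02 := h1 0 2
  have b03 := h1 0 3
  have b04 := h1 0 4
  have b05 := h1 0 5
  have b06 := h1 0 6
  have b12 := h1 1 2
  have b13 := h1 1 3
  have b23 := h1 2 3
  clear h1 hs hd hsum
  generalize A 0 1 = a01 at *
  generalize A 0 2 = a02 at *
  generalize A 0 3 = a03 at *
  generalize A 0 4 = a04 at *
  generalize A 0 5 = a05 at *
  generalize A 0 6 = a06 at *
  generalize A 1 2 = a12 at *
  generalize A 1 3 = a13 at *
  generalize A 2 3 = a23 at *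
  have e1 : a01 = 1 := by clear s1 s2 s3 s4 s5 s6; omega
  have e2 : a02 = 1 := by clear s1 s2 s3 s4 s5 s6; omega
  have e3 : a03 = 1 := by clear s1 s2 s3 s4 s5 s6; omega
  have e4 : a04 = 1 := by clear s1 s2 s3 s4 s5 s6; omega
  have e5 : a05 = 1 := by clear s1 s2 s3 s4 s5 s6; omega
  have e6 : a06 = 1 := by clear s1 s2 s3 s4 s5 s6; omega
  subst e1 e2 e3 e4 e5 e6
  clear s0 b01 b02 b03 b04 b05 b06
  have t : 2 * (a12 + a13 + a23) = 6 + 2 * (A 4 5 + A 4 6 + A 5 6) := by linarith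
  have f1 : a12 = 1 := by clear s1 s2 s3 s4 s5 s6; omega
  have f2 : a13 = 1 := by clear s1 s2 s3 s4 s5 s6; omega
  have f3 : a23 = 1 := by clear s1 s2 s3 s4 s5 s6; omega
  subst f1 f2 f3
  have g1 : A 4 5 = 0 := by clear s1 s2 s3 s4 s5 s6; omega
  have g2 : A 4 6 = 0 := by clear s1 s2 s3 s4 s5 s6; omega
  have g3 : A 5 6 = 0 := by clear s1 s2 s3 s4 s5 s6; omega
  rw [g1, g2] at s4
  rw [g1, g3] at s5
  rw [g2, g3] at s6
  refine ⟨by simp, by simp, ⟨g1, g2, g3⟩, ⟨?_, ?_, ?_⟩, ?_, ?_, ?_⟩ <;> linarith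

lemma canon_of_diag (A : Fin 7 → Fin 7 → ℕ) (hs : ∀ i j, A i j = A j i)
    (hd : ∀ i, A i i = 0) (h1 : ∀ i j, A i j ≤ 1)
    (hsum : ∀ i, ∑ j, A i j = (![6,5,5,5,3,3,3] : Fin 7 → ℕ) i)
    (h14 : A 1 4 = 0) (h25 : A 2 5 = 0) (h36 : A 3 6 = 0) (i j : Fin 7) :
    A i j = canonA i j := by
  obtain ⟨⟨e1, e2, e3, e4, e5, e6⟩, ⟨f1, f2, f3⟩, ⟨g1, g2, g3⟩, ⟨r1, r2, r3⟩, -⟩ :=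
    facts A hs hd h1 hsum
  have b15 := h1 1 5
  have b16 := h1 1 6
  have b24 := h1 2 4
  have b26 := h1 2 6
  have b34 := h1 3 4
  have b35 := h1 3 5
  have a15 : A 1 5 = 1 := by omega
  have a16 : A 1 6 = 1 := by omega
  have a24 : A 2 4 = 1 := by omega
  have a26 : A 2 6 = 1 := by omega
  have a34 : A 3 4 = 1 := by omega
  have a35 : A 3 5 = 1 := by omega
  have up : ∀ i j : Fin 7, i < j → A i j = canonA i j := by
    intro i j hij
    fin_cases i <;> fin_cases j <;> first
      | exact absurd hij (by decide)
      | assumption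
  rcases lt_trichotomy i j with h | h | h
  · exact up i j h
  · subst h
    rw [hd]
    clear * -
    revert i
    decide
  · rw [hs, up j i h]
    clear * -
    revert i j
    decide

lemma exists_canon (A : Fin 7 → Fin 7 → ℕ) (hs : ∀ i j, A i j = A j i)
    (hd : ∀ i, A i i = 0) (h1 : ∀ i j, A i j ≤ 1)
    (hsum : ∀ i, ∑ j, A i j = (![6,5,5,5,3,3,3] : Fin 7 → ℕ) i) :
    ∃ τ : Equiv.Perm (Fin 7), ∀ i j, A (τ i) (τ j) = canonA i j := by
  have main : ∀ (τ : Equiv.Perm (Fin 7)) (a b c : Fin 7),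
      (∀ i, (![6,5,5,5,3,3,3] : Fin 7 → ℕ) (τ i) = (![6,5,5,5,3,3,3] : Fin 7 → ℕ) i) →
      τ 1 = 1 ∧ τ 2 = 2 ∧ τ 3 = 3 ∧ τ 4 = a ∧ τ 5 = b ∧ τ 6 = c →
      A 1 a = 0 ∧ A 2 b = 0 ∧ A 3 c = 0 →
      ∃ τ : Equiv.Perm (Fin 7), ∀ i j, A (τ i) (τ j) = canonA i j := by
    rintro τ a b c hτ ⟨t1, t2, t3, t4, t5, t6⟩ ⟨ha, hb, hc⟩
    refine ⟨τ, canon_of_diag (fun i j => A (τ i) (τ j)) (fun i j => hs _ _) (fun i => hd _)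
      (fun i j => h1 _ _) (fun i => ?_) ?_ ?_ ?_⟩
    · rw [← hτ i, ← hsum, Equiv.sum_comp τ (fun j => A (τ i) j)]
    · simpa only [t1, t4] using ha
    · simpa only [t2, t5] using hb
    · simpa only [t3, t6] using hc
  have key : (A 1 4 = 0 ∧ A 2 5 = 0 ∧ A 3 6 = 0) ∨ (A 1 4 = 0 ∧ A 2 6 = 0 ∧ A 3 5 = 0) ∨
      (A 1 5 = 0 ∧ A 2 4 = 0 ∧ A 3 6 = 0) ∨ (A 1 5 = 0 ∧ A 2 6 = 0 ∧ A 3 4 = 0) ∨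
      (A 1 6 = 0 ∧ A 2 4 = 0 ∧ A 3 5 = 0) ∨ (A 1 6 = 0 ∧ A 2 5 = 0 ∧ A 3 4 = 0) := by
    obtain ⟨-, -, -, ⟨r1, r2, r3⟩, c4, c5, c6⟩ := facts A hs hd h1 hsum
    have b14 := h1 1 4
    have b15 := h1 1 5
    have b16 := h1 1 6
    have b24 := h1 2 4
    have b25 := h1 2 5
    have b26 := h1 2 6
    have b34 := h1 3 4
    have b35 := h1 3 5
    have b36 := h1 3 6
    rcases (by omega : A 1 4 = 0 ∨ A 1 5 = 0 ∨ A 1 6 = 0) with h | h | h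
    · rcases (by omega : A 2 5 = 0 ∨ A 2 6 = 0) with h' | h'
      · exact Or.inl ⟨h, h', by omega⟩
      · exact Or.inr (Or.inl ⟨h, h', by omega⟩)
    · rcases (by omega : A 2 4 = 0 ∨ A 2 6 = 0) with h' | h'
      · exact Or.inr (Or.inr (Or.inl ⟨h, h', by omega⟩))
      · exact Or.inr (Or.inr (Or.inr (Or.inl ⟨h, h', by omega⟩)))
    · rcases (by omega : A 2 4 = 0 ∨ A 2 5 = 0) with h' | h'
      · exact Or.inr (Or.inr (Or.inr (Or.inr (Or.inl ⟨h, h', by omega⟩))))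
      · exact Or.inr (Or.inr (Or.inr (Or.inr (Or.inr ⟨h, h', by omega⟩))))
  rcases key with h | h | h | h | h | h
  · exact main 1 4 5 6 (by decide) (by decide) h
  · exact main (Equiv.swap 5 6) 4 6 5 (by decide) (by decide) h
  · exact main (Equiv.swap 4 5) 5 4 6 (by decide) (by decide) h
  · exact main (Equiv.swap 4 5 * Equiv.swap 5 6) 5 6 4 (by decide) (by decide) h
  · exact main (Equiv.swap 5 6 * Equiv.swap 4 5) 6 4 5 (by decide) (by decide) h
  · exact main (Equiv.swap 4 6) 6 5 4 (by decide) (by decide) h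

lemma exists_perm_of_map_eq (f g : Fin 7 → ℕ)
    (h : Multiset.map f Finset.univ.val = Multiset.map g Finset.univ.val) :
    ∃ σ : Equiv.Perm (Fin 7), ∀ i, g (σ i) = f i := by
  have e : ∀ c, Nonempty ({a // f a = c} ≃ {b // g b = c}) := by
    intro c
    rw [← Fintype.card_eq, Fintype.card_subtype, Fintype.card_subtype]
    have := congrArg (Multiset.count c) h
    rw [Multiset.count_map, Multiset.count_map] at this
    simpa [Finset.card, eq_comm] using this
  exact ⟨Equiv.ofFiberEquiv (fun c => (e c).some), fun i => Equiv.ofFiberEquiv_map _ i⟩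

lemma exists_iso (G : SimpleGraph (Fin 7)) [DecidableRel G.Adj]
    (h : Multiset.map (fun v => G.degree v) Finset.univ.val
        = ({6, 5, 5, 5, 3, 3, 3} : Multiset ℕ)) :
    ∃ τ : Equiv.Perm (Fin 7), ∀ i j, G.Adj (τ i) (τ j) ↔ canonA i j = 1 := by
  have h2 : Multiset.map (![6,5,5,5,3,3,3] : Fin 7 → ℕ) Finset.univ.val
        = ({6, 5, 5, 5, 3, 3, 3} : Multiset ℕ) := by decide
  obtain ⟨σ, hσ⟩ := exists_perm_of_map_eq _ _ (h2.trans h.symm)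
  obtain ⟨τ, hτ⟩ := exists_canon (fun i j => if G.Adj (σ i) (σ j) then 1 else 0)
    (fun i j => by simp [G.adj_comm]) (fun i => by simp)
    (fun i j => by split_ifs <;> simp) (fun i => by
      rw [← hσ]
      rw [Equiv.sum_comp σ (fun j => if G.Adj (σ i) j then 1 else 0)]
      simp [← SimpleGraph.card_neighborFinset_eq_degree, SimpleGraph.neighborFinset_eq_filter])
  refine ⟨τ.trans σ, fun i j => ?_⟩
  have := hτ i j
  rw [← this]
  simp

/-- **The degree sequence `6, 5, 5, 5, 3, 3, 3` is unigraphic.**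
Any two simple graphs on 7 vertices, each with one vertex of degree 6, three
vertices of degree 5 and three vertices of degree 3, are isomorphic. -/
theorem unigraphic_6555333 :
    ∀ (G H : SimpleGraph (Fin 7)) [DecidableRel G.Adj] [DecidableRel H.Adj],
      Multiset.map (fun v => G.degree v) Finset.univ.val
        = ({6, 5, 5, 5, 3, 3, 3} : Multiset ℕ) →
      Multiset.map (fun v => H.degree v) Finset.univ.val
        = ({6, 5, 5, 5, 3, 3, 3} : Multiset ℕ) →
      Nonempty (G ≃g H) := by
  intro G H _ _ hG hH
  obtain ⟨τ, hτ⟩ := exists_iso G hG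
  obtain ⟨ρ, hρ⟩ := exists_iso H hH
  refine ⟨⟨τ.symm.trans ρ, fun {a b} => ?_⟩⟩
  have h1 := hτ (τ.symm a) (τ.symm b)
  simp only [Equiv.apply_symm_apply] at h1
  simp only [Equiv.trans_apply]
  rw [hρ, h1]
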